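/- For a > 0 and reals b < c, the n-th moment of μ_{sc,2√a} ⊞ Unif_{[b,c]} equals n! * ∑_{k=0}^{n} (c^{n-k}/(n-k)!) * ∑_{j=⌈k/2⌉}^{k} (c-b)^{2j-k} a^{k-j} / (j!(1+j)!) * s(1+j, k+1-j). -/

import Mathlib

open MeasureTheory

/-- Signed Stirling numbers of the first kind. -/
def stirlingS1 : ℕ → ℕ → ℤ
  | 0, 0 => 1
  | 0, _ + 1 => 0
  | _ + 1, 0 => 0
  | n + 1, k + 1 => stirlingS1 n k - n * stirlingS1 n (k + 1)

/-- The `n`-th moment of a measure on `ℝ`. -/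
noncomputable def moment (μ : Measure ℝ) (n : ℕ) : ℝ := ∫ x, x ^ n ∂μ

/-- The free cumulants of a measure on `ℝ`, defined recursively through the
moment–cumulant relation `mₙ = ∑_{s=1}^n κ_s ∑_{i₁+⋯+i_s = n-s} m_{i₁} ⋯ m_{i_s}`,
which for measures with all moments finite is equivalent to the usual definition via
sums over non-crossing partitions. -/
noncomputable def freeCumulant (μ : Measure ℝ) : ℕ → ℝ
  | 0 => 0
  | n + 1 =>
    moment μ (n + 1) -
      ∑ s ∈ (Finset.range n).attach,
        freeCumulant μ (s.1 + 1) *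
          ∑ p ∈ Finset.Nat.antidiagonalTuple (s.1 + 1) (n - s.1),
            ∏ j, moment μ (p j)
  decreasing_by
    have := s.2
    simp only [Finset.mem_range] at this
    omega

/-- `IsFreeAdd μ ν ρ` asserts that `ρ` is the free additive convolution `μ ⊞ ν`,
characterized by additivity of free cumulants. -/
def IsFreeAdd (μ ν ρ : Measure ℝ) : Prop :=
  ∀ n : ℕ, freeCumulant ρ n = freeCumulant μ n + freeCumulant ν n

/-- The semicircle distribution of radius `R`. -/
noncomputable def semicircle (R : ℝ) : Measure ℝ :=
  (volume.restrict (Set.Icc (-R) R)).withDensity fun x =>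
    ENNReal.ofReal (2 / (Real.pi * R ^ 2) * Real.sqrt (R ^ 2 - x ^ 2))

/-- The uniform distribution on `[a, b]`. -/
noncomputable def unif (a b : ℝ) : Measure ℝ :=
  (ENNReal.ofReal (b - a))⁻¹ • volume.restrict (Set.Icc a b)

open PowerSeries in
/-- Lagrange inversion for the powers of a solution of `X * M = X * φ(X * M)`. -/
theorem PowerSeries.mul_coeff_X_mul_pow_of_eq_subst {φ M : ℝ⟦X⟧} (h : M = φ.subst (X * M))
    (n r : ℕ) (hr : r ≠ 0) :
    ((n + r : ℕ) : ℝ) * coeff (n + r) ((X * M) ^ r) = r * coeff n (φ ^ (n + r)) := by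
  have hs : HasSubst (X * M) := HasSubst.of_constantCoeff_zero' (by simp)
  induction n using Nat.strong_induction_on generalizing r with
  | _ n ih =>
  rw [mul_pow, add_comm n r, coeff_X_pow_mul', if_pos (Nat.le_add_right r n),
    Nat.add_sub_cancel_left]
  have hM : M ^ r = (φ ^ r).subst (X * M) := by rw [subst_pow hs, ← h]
  rw [hM, coeff_subst' hs, finsum_eq_sum_of_support_subset (s := Finset.range (n + 1))]
  swap
  · intro d hd
    simp only [Finset.coe_range, Set.mem_Iio]
    by_contra hlt
    apply hd
    simp only [mul_pow, coeff_X_pow_mul', smul_eq_mul]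
    rw [if_neg (by omega), mul_zero]
  obtain rfl | hn := Nat.eq_zero_or_pos n
  · simp
  have hn' : (n : ℝ) ≠ 0 := by positivity
  have key : (n : ℝ) * ∑ d ∈ Finset.range (n + 1),
      coeff d (φ ^ r) • coeff n ((X * M) ^ d) = coeff n (X * d⁄dX ℝ (φ ^ r) * φ ^ n) := by
    rw [coeff_mul, Finset.Nat.sum_antidiagonal_eq_sum_range_succ_mk, Finset.mul_sum]
    refine Finset.sum_congr rfl fun d hd => ?_
    obtain _ | d := d
    · simp [hn.ne']
    · have hdn : d + 1 ≤ n := by simpa [Nat.lt_succ_iff] using hd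
      have := ih (n - (d + 1)) (by omega) (d + 1) (by omega)
      rw [Nat.sub_add_cancel hdn] at this
      rw [smul_eq_mul, mul_left_comm, this, coeff_succ_X_mul, coeff_derivative]
      push_cast
      ring
  have hd : ((n + r : ℕ) : ℝ⟦X⟧) * (X * d⁄dX ℝ (φ ^ r) * φ ^ n) =
      (r : ℝ⟦X⟧) * (X * d⁄dX ℝ (φ ^ (n + r))) := by
    rw [derivative_pow, derivative_pow, show n + r - 1 = n + (r - 1) by omega]
    ring
  have hc := congrArg (coeff n) hd
  obtain ⟨m, rfl⟩ := Nat.exists_eq_succ_of_ne_zero hn.ne'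
  rw [← map_natCast (C (R := ℝ)), ← map_natCast (C (R := ℝ)), coeff_C_mul, coeff_C_mul, ← key,
    Nat.succ_eq_add_one, coeff_succ_X_mul, coeff_derivative] at hc
  apply mul_left_cancel₀ hn'
  rw [add_comm r (m + 1)]
  simp only [Nat.succ_eq_add_one] at *
  push_cast at *
  linear_combination hc

open PowerSeries in
/-- Power series with constant coefficient one are determined by `[Xⁿ] φ ^ (n + 1)`. -/
theorem PowerSeries.eq_of_coeff_pow_succ_eq {φ ψ : ℝ⟦X⟧} (hφ : constantCoeff φ = 1)
    (hψ : constantCoeff ψ = 1)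
    (h : ∀ n, coeff n (φ ^ (n + 1)) = coeff n (ψ ^ (n + 1))) : φ = ψ := by
  ext n
  induction n using Nat.strong_induction_on with
  | _ n ih =>
  obtain ⟨χ, hχ⟩ : X ^ n ∣ φ - ψ := by
    rw [X_pow_dvd_iff]
    intro m hm
    rw [map_sub, ih m hm, sub_self]
  have hn : coeff n φ - coeff n ψ = constantCoeff χ := by
    rw [← map_sub, hχ, coeff_X_pow_mul', if_pos le_rfl, Nat.sub_self, coeff_zero_eq_constantCoeff]
  have h0 := sub_eq_zero.2 (h n)
  rw [← map_sub, ← (Commute.all φ ψ).geom_sum₂_mul, hχ, mul_left_comm, coeff_X_pow_mul',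
    if_pos le_rfl, Nat.sub_self, coeff_zero_eq_constantCoeff] at h0
  simp only [map_mul, map_sum, map_pow, hφ, hψ, one_pow, Finset.sum_const, mul_one,
    Finset.card_range, nsmul_eq_mul] at h0
  have : ((n + 1 : ℕ) : ℝ) ≠ 0 := by positivity
  rw [← sub_eq_zero, hn]
  exact (mul_eq_zero.1 h0).resolve_left this

open PowerSeries in
theorem PowerSeries.coeff_pow_eq_sum_antidiagonalTuple (f : ℝ⟦X⟧) (s n : ℕ) :
    coeff n (f ^ s) = ∑ p ∈ Finset.Nat.antidiagonalTuple s n, ∏ j, coeff (p j) f := by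
  classical
  have : f ^ s = ∏ _j : Fin s, f := by simp
  rw [this, coeff_prod]
  refine Finset.sum_nbij' (fun l => ⇑l) (fun p => Finsupp.equivFunOnFinite.symm p) ?_ ?_ ?_ ?_ ?_
  · intro l hl
    simpa [Finset.mem_finsuppAntidiag, Finset.Nat.mem_antidiagonalTuple] using hl
  · intro l hl
    simpa [Finset.mem_finsuppAntidiag, Finset.Nat.mem_antidiagonalTuple] using hl
  · intro l _
    ext; simp
  · intro l _
    ext; simp
  · intro l _
    rfl

/-- The series `w K(w)`, where `K` is the functional inverse of the Cauchy transform. -/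
noncomputable def cumulantSeries (μ : Measure ℝ) : PowerSeries ℝ :=
  1 + PowerSeries.mk (freeCumulant μ)

open PowerSeries in
theorem moment_eq_coeff_cumulantSeries_pow {μ : Measure ℝ} (h0 : moment μ 0 = 1) (n : ℕ) :
    ((n + 1 : ℕ) : ℝ) * moment μ n = coeff n (cumulantSeries μ ^ (n + 1)) := by
  set M : PowerSeries ℝ := PowerSeries.mk (moment μ) with hM
  have hs : HasSubst (X * M) := HasSubst.of_constantCoeff_zero' (by simp)
  have h : M = (cumulantSeries μ).subst (X * M) := by
    ext n
    rw [coeff_subst' hs, finsum_eq_sum_of_support_subset (s := Finset.range (n + 1))]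
    swap
    · intro d hd
      simp only [Finset.coe_range, Set.mem_Iio]
      by_contra hlt
      apply hd
      simp only [mul_pow, coeff_X_pow_mul', smul_eq_mul]
      rw [if_neg (by omega), mul_zero]
    obtain _ | n := n
    · simp [cumulantSeries, hM, h0, freeCumulant]
    · rw [Finset.sum_range_succ']
      have hterm : ∀ d ∈ Finset.range (n + 1),
          coeff (d + 1) (cumulantSeries μ) • coeff (n + 1) ((X * M) ^ (d + 1)) =
          freeCumulant μ (d + 1) * ∑ p ∈ Finset.Nat.antidiagonalTuple (d + 1) (n - d),
            ∏ j, moment μ (p j) := by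
        intro d hd
        have hd' : d ≤ n := by simpa [Nat.lt_succ_iff] using hd
        rw [mul_pow, coeff_X_pow_mul', if_pos (by omega), Nat.add_sub_add_right,
          coeff_pow_eq_sum_antidiagonalTuple]
        simp [cumulantSeries, hM, coeff_one]
      rw [Finset.sum_congr rfl hterm, Finset.sum_range_succ, freeCumulant,
        Finset.sum_attach (Finset.range n) fun s => freeCumulant μ (s + 1) *
          ∑ p ∈ Finset.Nat.antidiagonalTuple (s + 1) (n - s), ∏ j, moment μ (p j)]
      simp [hM, coeff_one, h0, Finset.Nat.antidiagonalTuple_zero_right]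
  have := mul_coeff_X_mul_pow_of_eq_subst h n 1 one_ne_zero
  rw [pow_one, coeff_succ_X_mul, Nat.cast_one, one_mul] at this
  rw [← this, hM, coeff_mk]

open PowerSeries in
theorem cumulantSeries_eq_of_moment {μ : Measure ℝ} {φ : PowerSeries ℝ}
    (hφ : constantCoeff φ = 1)
    (h : ∀ n, ((n + 1 : ℕ) : ℝ) * moment μ n = coeff n (φ ^ (n + 1))) :
    cumulantSeries μ = φ := by
  have h0 : moment μ 0 = 1 := by simpa [hφ] using h 0
  refine eq_of_coeff_pow_succ_eq (by simp [cumulantSeries, freeCumulant]) hφ fun n => ?_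
  rw [← moment_eq_coeff_cumulantSeries_pow h0, h]

theorem stirlingS1_eq_zero_of_lt {n k : ℕ} (h : n < k) : stirlingS1 n k = 0 := by
  induction n generalizing k with
  | zero => obtain _ | k := k <;> simp_all [stirlingS1]
  | succ n ih =>
    obtain _ | k := k
    · omega
    · simp [stirlingS1, ih (k := k) (by omega), ih (k := k + 1) (by omega)]

open PowerSeries in
theorem X_mul_derivative_bernoulliPowerSeries :
    X * d⁄dX ℝ (bernoulliPowerSeries ℝ) =
      (1 - X) * bernoulliPowerSeries ℝ - bernoulliPowerSeries ℝ ^ 2 := by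
  have h := bernoulliPowerSeries_mul_exp_sub_one ℝ
  have hd := congrArg (d⁄dX ℝ) h
  have he : d⁄dX ℝ (exp ℝ) = exp ℝ := by
    ext n
    simp only [coeff_derivative, coeff_exp, Nat.factorial_succ]
    have : (n.factorial : ℝ) ≠ 0 := by positivity
    simp
    field_simp
  rw [Derivation.leibniz, map_sub, he, derivative_X, derivative_one, sub_zero] at hd
  simp only [smul_eq_mul] at hd
  linear_combination (bernoulliPowerSeries ℝ) * hd - (d⁄dX ℝ (bernoulliPowerSeries ℝ) +
    bernoulliPowerSeries ℝ) * h

open PowerSeries in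
theorem coeff_bernoulliPowerSeries_pow_succ (j m : ℕ) (hm : m ≤ j) :
    coeff m (bernoulliPowerSeries ℝ ^ (j + 1)) =
      stirlingS1 (j + 1) (j + 1 - m) * (j - m).factorial / j.factorial := by
  induction j generalizing m with
  | zero =>
    obtain rfl : m = 0 := by omega
    simp [bernoulliPowerSeries, stirlingS1]
  | succ j ih =>
    have hrec : ((j + 1 : ℕ) : ℝ⟦X⟧) * bernoulliPowerSeries ℝ ^ (j + 2) =
        ((j + 1 : ℕ) : ℝ⟦X⟧) * (bernoulliPowerSeries ℝ ^ (j + 1) -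
          X * bernoulliPowerSeries ℝ ^ (j + 1)) -
          X * d⁄dX ℝ (bernoulliPowerSeries ℝ ^ (j + 1)) := by
      rw [derivative_pow, Nat.add_sub_cancel]
      linear_combination (((j + 1 : ℕ) : ℝ⟦X⟧) * bernoulliPowerSeries ℝ ^ j) *
        X_mul_derivative_bernoulliPowerSeries
    have hc := congrArg (coeff m) hrec
    have hj : ((j : ℝ) + 1) ≠ 0 := by positivity
    have hj' : (j.factorial : ℝ) ≠ 0 := by positivity
    rw [← map_natCast (C (R := ℝ)), coeff_C_mul, map_sub, coeff_C_mul, map_sub] at hc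
    obtain _ | m := m
    · simp only [coeff_zero_X_mul, sub_zero] at hc
      rw [ih 0 (Nat.zero_le _)] at hc
      have : stirlingS1 (j + 2) (j + 2) = stirlingS1 (j + 1) (j + 1) := by
        rw [stirlingS1, stirlingS1_eq_zero_of_lt (Nat.lt_succ_self (j + 1))]; simp
      simp only [Nat.sub_zero, this]
      have h1 : (((j + 1).factorial : ℕ) : ℝ) ≠ 0 := by positivity
      simp only [Nat.sub_zero] at hc
      have h2 : (((j + 1 : ℕ)) : ℝ) ≠ 0 := by positivity
      rw [mul_div_assoc, div_self h1, mul_left_cancel₀ h2 hc, mul_div_assoc, div_self hj']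
    · rw [coeff_succ_X_mul, coeff_succ_X_mul, coeff_derivative, ih m (by omega)] at hc
      have hstep : stirlingS1 (j + 2) (j + 1 - m) =
          stirlingS1 (j + 1) (j - m) - (j + 1 : ℕ) * stirlingS1 (j + 1) (j + 1 - m) := by
        rw [show j + 1 - m = j - m + 1 by omega, stirlingS1]
      rw [show j + 1 + 1 - (m + 1) = j + 1 - m by omega, hstep,
        show j + 1 - (m + 1) = j - m by omega, Nat.factorial_succ]
      obtain hmj | rfl : m + 1 ≤ j ∨ m = j := by omega
      · rw [ih (m + 1) hmj] at hc
        obtain ⟨i, rfl⟩ := Nat.exists_eq_add_of_le hmj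
        rw [show m + 1 + i - (m + 1) = i by omega, show m + 1 + i - m = i + 1 by omega,
          show m + 1 + i + 1 - (m + 1) = i + 1 by omega] at *
        rw [Nat.factorial_succ i] at *
        push_cast at *
        field_simp at hc ⊢
        linear_combination hc
      · have hzero : stirlingS1 (m + 1) 0 = 0 := by simp [stirlingS1]
        simp only [Nat.sub_self, hzero, Nat.add_sub_cancel_left, Nat.factorial_zero] at *
        push_cast at *
        field_simp at hc ⊢
        linear_combination ((m : ℝ) + 1) * hc

theorem stirlingS1_succ_one (j : ℕ) : stirlingS1 (j + 1) 1 = (-1) ^ j * j.factorial := by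
  induction j with
  | zero => simp [stirlingS1]
  | succ j ih =>
    rw [stirlingS1, ih, stirlingS1, Nat.factorial_succ]
    push_cast
    ring

open PowerSeries in
theorem coeff_add_C_mul_X_pow_succ (ψ : PowerSeries ℝ) (c : ℝ) (n : ℕ) :
    coeff n ((ψ + C c * X) ^ (n + 1)) = ∑ k ∈ Finset.range (n + 1),
      ((n + 1).choose (k + 1) : ℝ) * c ^ (n - k) * coeff k (ψ ^ (k + 1)) := by
  rw [add_pow, map_sum, Finset.sum_range_succ']
  have h0 : coeff n (ψ ^ 0 * (C c * X) ^ (n + 1 - 0) * ((n + 1).choose 0 : PowerSeries ℝ)) = 0 := by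
    rw [mul_pow, ← map_pow, pow_zero, one_mul, Nat.choose_zero_right, Nat.cast_one, mul_one,
      Nat.sub_zero, coeff_C_mul, coeff_X_pow, if_neg (by omega), mul_zero]
  rw [h0, add_zero]
  refine Finset.sum_congr rfl fun k hk => ?_
  have hk' : k ≤ n := by simpa [Nat.lt_succ_iff] using hk
  rw [Nat.add_sub_add_right, mul_pow, ← map_pow, ← map_natCast (C (R := ℝ)),
    show ψ ^ (k + 1) * (C (c ^ (n - k)) * X ^ (n - k)) * C (((n + 1).choose (k + 1) : ℕ) : ℝ) =
      C ((((n + 1).choose (k + 1) : ℕ) : ℝ) * c ^ (n - k)) * (X ^ (n - k) * ψ ^ (k + 1)) by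
      rw [map_mul]; ring,
    coeff_C_mul, coeff_X_pow_mul', if_pos (Nat.sub_le n k), Nat.sub_sub_self hk']

open PowerSeries in
theorem coeff_add_C_mul_X_sq_pow_succ (ψ : PowerSeries ℝ) (a : ℝ) (k : ℕ) :
    coeff k ((ψ + C a * X ^ 2) ^ (k + 1)) = ∑ j ∈ Finset.Icc ((k + 1) / 2) k,
      ((k + 1).choose (j + 1) : ℝ) * a ^ (k - j) * coeff (2 * j - k) (ψ ^ (j + 1)) := by
  rw [add_pow, map_sum, Finset.sum_range_succ']
  have h0 : coeff k (ψ ^ 0 * (C a * X ^ 2) ^ (k + 1 - 0) * ((k + 1).choose 0 : PowerSeries ℝ)) =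
      0 := by
    rw [mul_pow, ← map_pow, ← pow_mul, pow_zero, one_mul, Nat.choose_zero_right, Nat.cast_one,
      mul_one, Nat.sub_zero, coeff_C_mul, coeff_X_pow, if_neg (by omega), mul_zero]
  rw [h0, add_zero]
  have hsub : Finset.Icc ((k + 1) / 2) k ⊆ Finset.range (k + 1) := by
    intro j hj
    simp only [Finset.mem_Icc, Finset.mem_range] at *
    omega
  have hform : ∀ j, ψ ^ (j + 1) * (C a * X ^ 2) ^ (k + 1 - (j + 1)) *
      ((k + 1).choose (j + 1) : PowerSeries ℝ) =
      C ((((k + 1).choose (j + 1) : ℕ) : ℝ) * a ^ (k - j)) * (X ^ (2 * (k - j)) * ψ ^ (j + 1)) := by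
    intro j
    rw [Nat.add_sub_add_right, map_mul, map_pow, map_natCast, pow_mul]
    ring
  simp_rw [hform, coeff_C_mul, coeff_X_pow_mul']
  rw [← Finset.sum_subset hsub]
  · refine Finset.sum_congr rfl fun j hj => ?_
    simp only [Finset.mem_Icc] at hj
    rw [if_pos (by omega), show k - 2 * (k - j) = 2 * j - k by omega]
  · intro j hj hj'
    simp only [Finset.mem_Icc, Finset.mem_range] at *
    rw [if_neg (by omega), mul_zero]

theorem moment_unif {b c : ℝ} (hbc : b < c) (n : ℕ) :
    moment (unif b c) n = (c - b)⁻¹ * ((c ^ (n + 1) - b ^ (n + 1)) / (n + 1)) := by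
  rw [moment, unif, integral_smul_measure, integral_Icc_eq_integral_Ioc,
    ← intervalIntegral.integral_of_le hbc.le, integral_pow, ENNReal.toReal_inv,
    ENNReal.toReal_ofReal (sub_nonneg.2 hbc.le), smul_eq_mul]

theorem moment_semicircle {R : ℝ} (hR : 0 < R) (n : ℕ) :
    moment (semicircle R) n =
      2 * R ^ n / (Real.pi * (n + 2)) * ∫ x in (0 : ℝ)..Real.pi, Real.cos x ^ n := by
  have hpi := Real.pi_pos
  have h1 : moment (semicircle R) n =
      ∫ x in (-R)..R, 2 / (Real.pi * R ^ 2) * Real.sqrt (R ^ 2 - x ^ 2) * x ^ n := by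
    rw [moment, semicircle, integral_withDensity_eq_integral_toReal_smul
      (f := fun x => ENNReal.ofReal (2 / (Real.pi * R ^ 2) * Real.sqrt (R ^ 2 - x ^ 2)))
      (by fun_prop) (by simp),
      integral_Icc_eq_integral_Ioc, ← intervalIntegral.integral_of_le (by linarith)]
    refine intervalIntegral.integral_congr fun x _ => ?_
    simp only [smul_eq_mul]
    rw [ENNReal.toReal_ofReal (by positivity)]
  have hsub := intervalIntegral.integral_comp_mul_deriv (a := 0) (b := Real.pi)
    (f := fun θ => R * Real.cos θ) (f' := fun θ => R * -Real.sin θ)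
    (g := fun x => 2 / (Real.pi * R ^ 2) * Real.sqrt (R ^ 2 - x ^ 2) * x ^ n)
    (fun θ _ => (Real.hasDerivAt_cos θ).const_mul R) (by fun_prop) (by fun_prop)
  rw [Real.cos_zero, Real.cos_pi, mul_one, mul_neg_one] at hsub
  rw [h1, intervalIntegral.integral_symm, ← hsub, ← intervalIntegral.integral_neg]
  have h2 : ∀ θ ∈ Set.uIcc 0 Real.pi,
      -(((fun x => 2 / (Real.pi * R ^ 2) * Real.sqrt (R ^ 2 - x ^ 2) * x ^ n) ∘
        fun θ => R * Real.cos θ) θ * (R * -Real.sin θ)) =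
      2 * R ^ n / Real.pi * (Real.cos θ ^ n - Real.cos θ ^ (n + 2)) := by
    intro θ hθ
    rw [Set.uIcc_of_le hpi.le] at hθ
    have hs : Real.sqrt (R ^ 2 - (R * Real.cos θ) ^ 2) = R * Real.sin θ := by
      rw [← Real.sqrt_sq (mul_nonneg hR.le (Real.sin_nonneg_of_mem_Icc hθ))]
      congr 1
      rw [mul_pow, mul_pow, Real.sin_sq]
      ring
    simp only [Function.comp_apply, hs]
    have : Real.cos θ ^ (n + 2) = Real.cos θ ^ n * (1 - Real.sin θ ^ 2) := by
      rw [← Real.cos_sq', pow_add]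
    rw [this]
    field_simp
    ring
  rw [intervalIntegral.integral_congr h2, intervalIntegral.integral_const_mul,
    intervalIntegral.integral_sub (Continuous.intervalIntegrable (by fun_prop) _ _)
      (Continuous.intervalIntegrable (by fun_prop) _ _), integral_cos_pow]
  simp only [Real.sin_pi, Real.sin_zero]
  field_simp
  ring

theorem moment_semicircle_odd {R : ℝ} (hR : 0 < R) (k : ℕ) :
    moment (semicircle R) (2 * k + 1) = 0 := by
  rw [moment_semicircle hR]
  have : ∫ x in (0 : ℝ)..Real.pi, Real.cos x ^ (2 * k + 1) = 0 := by
    induction k with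
    | zero => simp
    | succ k ih =>
      rw [show 2 * (k + 1) + 1 = 2 * k + 1 + 2 by ring, integral_cos_pow, ih]
      simp
  rw [this, mul_zero]

theorem moment_semicircle_even {a : ℝ} (ha : 0 < a) (k : ℕ) :
    moment (semicircle (2 * Real.sqrt a)) (2 * k) = a ^ k * k.centralBinom / (k + 1) := by
  have hR : 0 < 2 * Real.sqrt a := by positivity
  have hpi := Real.pi_pos
  rw [moment_semicircle hR]
  have hint : ∀ k : ℕ, (4 : ℝ) ^ k * ∫ x in (0 : ℝ)..Real.pi, Real.cos x ^ (2 * k) =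
      Real.pi * k.centralBinom := by
    intro k
    induction k with
    | zero => simp
    | succ k ih =>
      have hb := Nat.succ_mul_centralBinom_succ k
      have hb' : ((k : ℝ) + 1) * (k + 1).centralBinom = 2 * (2 * k + 1) * k.centralBinom := by
        exact_mod_cast hb
      rw [show 2 * (k + 1) = 2 * k + 2 by ring, integral_cos_pow]
      simp only [Real.sin_pi, Real.sin_zero, mul_zero, sub_zero, zero_div, zero_add]
      push_cast
      have : (k : ℝ) + 1 ≠ 0 := by positivity
      have hk2 : (2 * (k : ℝ) + 2) ≠ 0 := by positivity
      apply mul_left_cancel₀ this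
      rw [mul_left_comm _ Real.pi, hb']
      field_simp
      rw [pow_succ]
      linear_combination 4 * ih
  have hsq : (2 * Real.sqrt a) ^ (2 * k) = 4 ^ k * a ^ k := by
    rw [pow_mul, mul_pow, Real.sq_sqrt ha.le, mul_pow]
    norm_num
  rw [hsq]
  have := hint k
  push_cast
  field_simp
  linear_combination this

open PowerSeries in
theorem cumulantSeries_unif {b c : ℝ} (hbc : b < c) :
    cumulantSeries (unif b c) = rescale (c - b) (bernoulliPowerSeries ℝ) + C c * X := by
  refine cumulantSeries_eq_of_moment ?_ fun n => ?_
  · rw [← coeff_zero_eq_constantCoeff_apply, map_add, coeff_rescale]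
    simp [bernoulliPowerSeries]
  have hd : c - b ≠ 0 := (sub_pos.2 hbc).ne'
  have hn : (n : ℝ) + 1 ≠ 0 := by positivity
  have hcoeff : ∀ k, coeff k (rescale (c - b) (bernoulliPowerSeries ℝ) ^ (k + 1)) =
      (b - c) ^ k := by
    intro k
    have hk : (k.factorial : ℝ) ≠ 0 := by positivity
    rw [← map_pow, coeff_rescale, coeff_bernoulliPowerSeries_pow_succ k k le_rfl,
      Nat.add_sub_cancel_left, stirlingS1_succ_one, ← neg_sub c b, neg_pow (c - b)]
    push_cast
    field_simp
    simp
  have hbin : (b - c) * ∑ k ∈ Finset.range (n + 1),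
      ((n + 1).choose (k + 1) : ℝ) * c ^ (n - k) * (b - c) ^ k = b ^ (n + 1) - c ^ (n + 1) := by
    have h := add_pow (b - c) c (n + 1)
    rw [sub_add_cancel, Finset.sum_range_succ'] at h
    rw [h, Finset.mul_sum]
    simp only [pow_zero, Nat.sub_zero, Nat.choose_zero_right, Nat.cast_one, mul_one, one_mul,
      add_sub_cancel_right, Nat.add_sub_add_right]
    exact Finset.sum_congr rfl fun k _ => by ring
  rw [coeff_add_C_mul_X_pow_succ, moment_unif hbc]
  simp_rw [hcoeff]
  push_cast
  field_simp
  linear_combination hbin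

open PowerSeries in
theorem cumulantSeries_semicircle {a : ℝ} (ha : 0 < a) :
    cumulantSeries (semicircle (2 * Real.sqrt a)) = 1 + C a * X ^ 2 := by
  refine cumulantSeries_eq_of_moment (by simp) fun n => ?_
  rw [coeff_add_C_mul_X_sq_pow_succ]
  simp only [one_pow, coeff_one]
  obtain ⟨k, rfl | rfl⟩ := n.even_or_odd'
  · rw [moment_semicircle_even ha, Finset.sum_eq_single_of_mem k (by simp; omega)]
    · rw [if_pos (by omega), mul_one, show 2 * k - k = k by omega]
      have h : (2 * k + 1) * k.centralBinom = (2 * k + 1).choose (k + 1) * (k + 1) := by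
        rw [Nat.centralBinom, Nat.add_one_mul_choose_eq]
      have h' : (2 * (k : ℝ) + 1) * k.centralBinom = (2 * k + 1).choose (k + 1) * (k + 1) := by
        exact_mod_cast h
      push_cast
      field_simp
      linear_combination h'
    · intro j hj hjk
      simp only [Finset.mem_Icc] at hj
      rw [if_neg (by omega), mul_zero]
  · rw [moment_semicircle_odd (by positivity), mul_zero, Finset.sum_eq_zero]
    intro j hj
    simp only [Finset.mem_Icc] at hj
    rw [if_neg (by omega), mul_zero]

theorem moment_semicircle_free_conv_unif_general (a b c : ℝ) (ha : 0 < a) (hbc : b < c)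
    (ρ : Measure ℝ) [IsProbabilityMeasure ρ]
    (hρ : IsFreeAdd (semicircle (2 * Real.sqrt a)) (unif b c) ρ) (n : ℕ) :
    moment ρ n =
      (n.factorial : ℝ) * ∑ k ∈ Finset.range (n + 1),
        c ^ (n - k) / ((n - k).factorial : ℝ) *
          ∑ j ∈ Finset.Icc ((k + 1) / 2) k,
            (c - b) ^ (2 * j - k) * a ^ (k - j) /
              ((j.factorial : ℝ) * ((1 + j).factorial : ℝ)) *
              (stirlingS1 (1 + j) (k + 1 - j) : ℝ) := by
  have h0 : moment ρ 0 = 1 := by simp [moment]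
  have hK : cumulantSeries ρ = (PowerSeries.rescale (c - b) (bernoulliPowerSeries ℝ) +
      PowerSeries.C a * PowerSeries.X ^ 2) + PowerSeries.C c * PowerSeries.X := by
    have h : cumulantSeries ρ =
        cumulantSeries (semicircle (2 * Real.sqrt a)) + cumulantSeries (unif b c) - 1 := by
      ext m
      simp [cumulantSeries, hρ m]
      ring
    rw [h, cumulantSeries_unif hbc, cumulantSeries_semicircle ha]
    ring
  have hn : ((n + 1 : ℕ) : ℝ) ≠ 0 := by positivity
  apply mul_left_cancel₀ hn
  rw [moment_eq_coeff_cumulantSeries_pow h0, hK, coeff_add_C_mul_X_pow_succ, ← mul_assoc,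
    ← Nat.cast_mul, ← Nat.factorial_succ, Finset.mul_sum]
  refine Finset.sum_congr rfl fun k hk => ?_
  have hk' : k + 1 ≤ n + 1 := by simpa using hk
  rw [coeff_add_C_mul_X_sq_pow_succ, Nat.cast_choose ℝ hk', Nat.add_sub_add_right, ← mul_assoc,
    Finset.mul_sum, Finset.mul_sum]
  refine Finset.sum_congr rfl fun j hj => ?_
  rw [Finset.mem_Icc] at hj
  have hjk : j + 1 ≤ k + 1 := by omega
  rw [← map_pow, PowerSeries.coeff_rescale, coeff_bernoulliPowerSeries_pow_succ j _ (by omega),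
    Nat.cast_choose ℝ hjk, Nat.add_sub_add_right, show j + 1 - (2 * j - k) = k + 1 - j by omega,
    show j - (2 * j - k) = k - j by omega, add_comm 1 j]
  have h1 : ((k + 1).factorial : ℝ) ≠ 0 := by positivity
  have h2 : ((k - j).factorial : ℝ) ≠ 0 := by positivity
  field_simp
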